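/- Take M = ℤ with φ = id, so that t_m is the cyclic rotation of ℤ^m and δ_m^n is n-fold concatenation; let D = colim_m ℤ^m and let t be the endomorphism of D induced by the rotations t_m. Let Δ : ℤ → D be induced by the diagonal maps ℤ → ℤ^m, and let S′ : D → ℚ be induced by the compatible maps ℤ^m → ℚ, f ↦ (Σ_{i=0}^{m−1} f_i)/m. Then the sequence 0 → ℤ → D → D → ℚ → 0, with maps Δ, t − id, and S′, is exact. -/

import Mathlib

/-- The positive integers, regarded as a directed partial order under divisibility. -/
structure DivIdx where
  val : ℕ
  pos : 0 < val
deriving DecidableEq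

instance : PartialOrder DivIdx where
  le a b := a.val ∣ b.val
  le_refl a := dvd_refl _
  le_trans a b c hab hbc := dvd_trans hab hbc
  le_antisymm a b hab hba := by
    cases a; cases b
    simp only [DivIdx.mk.injEq]
    exact Nat.dvd_antisymm hab hba

instance : IsDirected DivIdx (· ≤ ·) :=
  ⟨fun a b => ⟨⟨a.val * b.val, Nat.mul_pos a.pos b.pos⟩, Dvd.intro _ rfl, Dvd.intro_left _ rfl⟩⟩

/-- The direct system `m ↦ ℤ^m` over the divisibility order, with transition maps the
concatenation maps `(δ_m^n f) k = f (k mod m)` from stage `m` to stage `mn`. -/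
def piSystem (M : Type) [AddCommGroup M] :
    ∀ i j : DivIdx, i ≤ j → (Fin i.val → M) →+ (Fin j.val → M) :=
  fun i _ _ => AddMonoidHom.mk'
    (fun f k => f ⟨(k : ℕ) % i.val, Nat.mod_lt _ i.pos⟩) (fun _ _ => rfl)

/-- The colimit `D = colim_m ℤ^m`. -/
def DD (M : Type) [AddCommGroup M] : Type :=
  AddCommGroup.DirectLimit (fun i : DivIdx => Fin i.val → M) (piSystem M)

noncomputable instance (M : Type) [AddCommGroup M] : AddCommGroup (DD M) :=
  inferInstanceAs (AddCommGroup
    (AddCommGroup.DirectLimit (fun i : DivIdx => Fin i.val → M) (piSystem M)))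

/-- The canonical map `ℤ^m → D`. -/
noncomputable def ofD (M : Type) [AddCommGroup M] (i : DivIdx) : (Fin i.val → M) →+ DD M :=
  AddCommGroup.DirectLimit.of (fun i : DivIdx => Fin i.val → M) (piSystem M) i

/-- The cyclic rotation `t_m : ℤ^m → ℤ^m`, `(t_m f) i = f (i-1)`, at stage `m = i.val`. -/
def cycRotAt (M : Type) (i : DivIdx) (f : Fin i.val → M) : Fin i.val → M :=
  fun k => f (k - ⟨1 % i.val, Nat.mod_lt _ i.pos⟩)

/-- A compatible family of homomorphisms out of the stages descends to the colimit. -/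
theorem exists_hom_of_compatible {M P : Type} [AddCommGroup M] [AddCommGroup P]
    (g : ∀ i : DivIdx, (Fin i.val → M) →+ P)
    (hg : ∀ i j hij f, g j (piSystem M i j hij f) = g i f) :
    ∃ G : DD M →+ P, ∀ i f, G (ofD M i f) = g i f :=
  ⟨AddCommGroup.DirectLimit.lift (fun i : DivIdx => Fin i.val → M) (piSystem M) P g hg, fun i f =>
    AddCommGroup.DirectLimit.lift_of (f := piSystem M) P g hg i f⟩

theorem ofD_piSystem {M : Type} [AddCommGroup M] {i j : DivIdx} (hij : i ≤ j)
    (f : Fin i.val → M) : ofD M j (piSystem M i j hij f) = ofD M i f :=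
  AddCommGroup.DirectLimit.of_f (f := piSystem M) (hij := hij) (x := f)

theorem exists_ofD {M : Type} [AddCommGroup M] (d : DD M) : ∃ i f, ofD M i f = d := by
  have : Nonempty DivIdx := ⟨⟨1, one_pos⟩⟩
  exact AddCommGroup.DirectLimit.induction_on
    (C := fun d => ∃ (i : DivIdx) (f : Fin i.val → M), ofD M i f = d) d
    fun i f => ⟨i, f, rfl⟩

/-- An element of the stage `i` determines an `i`-periodic sequence, compatibly with the
transition maps; hence each stage embeds in the colimit. -/
theorem ofD_injective (M : Type) [AddCommGroup M] (i : DivIdx) :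
    Function.Injective (ofD M i) := by
  obtain ⟨ev, hev⟩ := exists_hom_of_compatible (M := M) (P := ℕ → M)
    (fun i => AddMonoidHom.mk'
      (fun f k => f ⟨k % i.val, Nat.mod_lt _ i.pos⟩) (fun _ _ => rfl)) (by
      intro i j hij f
      funext k
      simp only [piSystem, AddMonoidHom.mk'_apply]
      congr 2
      exact Nat.mod_mod_of_dvd k hij)
  intro f g h
  have h' := congrArg ev h
  rw [hev, hev] at h'
  funext k
  simpa [Nat.mod_eq_of_lt k.isLt] using congrFun h' k

theorem val_sub_one_mod {n : ℕ} (hn : 0 < n) (k : Fin n) :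
    ((k - ⟨1 % n, Nat.mod_lt _ hn⟩ : Fin n) : ℕ) = (k + (n - 1)) % n := by
  rw [Fin.sub_def]
  rcases (Nat.succ_le_iff.mpr hn).eq_or_lt with rfl | h
  · simp
  · simp only [Nat.mod_eq_of_lt h]
    congr 1
    omega

theorem cycRotAt_add {M : Type} [AddCommGroup M] (i : DivIdx) (f g : Fin i.val → M) :
    cycRotAt M i (f + g) = cycRotAt M i f + cycRotAt M i g := rfl

theorem cycRotAt_piSystem {M : Type} [AddCommGroup M] {i j : DivIdx} (hij : i ≤ j)
    (f : Fin i.val → M) :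
    cycRotAt M j (piSystem M i j hij f) = piSystem M i j hij (cycRotAt M i f) := by
  funext k
  simp only [piSystem, AddMonoidHom.mk'_apply, cycRotAt]
  congr 1
  apply Fin.ext
  rw [val_sub_one_mod i.pos]
  simp only [val_sub_one_mod j.pos]
  have hij' : i.val ∣ j.val := hij
  rw [Nat.mod_mod_of_dvd _ hij', Nat.mod_add_mod]
  obtain ⟨c, hc⟩ := hij'
  obtain _ | c := c
  · exact absurd hc j.pos.ne'
  · have hi := i.pos
    have h : (k : ℕ) + (j.val - 1) = (k + (i.val - 1)) + i.val * c := by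
      rw [Nat.mul_succ] at hc
      omega
    rw [h, Nat.add_mul_mod_self_left]

theorem sum_cycRotAt {M : Type} [AddCommMonoid M] (i : DivIdx) (f : Fin i.val → M) :
    ∑ k, cycRotAt M i f k = ∑ k, f k := by
  have : NeZero i.val := ⟨i.pos.ne'⟩
  exact Equiv.sum_comp (Equiv.subRight (⟨1 % i.val, Nat.mod_lt _ i.pos⟩ : Fin i.val)) f

theorem sum_piSystem {i j : DivIdx} (hij : i ≤ j) (f : Fin i.val → ℤ) :
    (∑ k, (piSystem ℤ i j hij f k : ℚ)) / (j.val : ℚ) = (∑ k, (f k : ℚ)) / (i.val : ℚ) := by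
  obtain ⟨i, hi⟩ := i
  obtain ⟨j, hj⟩ := j
  have hdvd : i ∣ j := hij
  obtain ⟨c, rfl⟩ := hdvd
  have hc : 0 < c := Nat.pos_of_mul_pos_left hj
  let F : ℕ → ℚ := fun k => f ⟨k % i, Nat.mod_lt _ hi⟩
  have hF : ∑ k, (f k : ℚ) = ∑ k ∈ Finset.range i, F k := by
    rw [← Fin.sum_univ_eq_sum_range]
    exact Finset.sum_congr rfl fun k _ => by simp [F, Nat.mod_eq_of_lt k.isLt]
  have hsum : ∀ c : ℕ, ∑ k ∈ Finset.range (i * c), F k = c * ∑ k ∈ Finset.range i, F k := by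
    intro c
    induction c with
    | zero => simp
    | succ c ih =>
      rw [Nat.mul_succ, Finset.sum_range_add, ih]
      simp only [F, Nat.mul_add_mod]
      push_cast
      ring
  have hG : ∑ k : Fin (i * c), (piSystem ℤ ⟨i, hi⟩ ⟨i * c, hj⟩ hij f k : ℚ) =
      ∑ k ∈ Finset.range (i * c), F k :=
    Fin.sum_univ_eq_sum_range F (i * c)
  simp only
  rw [hG, hsum, hF]
  have hi' : (i : ℚ) ≠ 0 := by positivity
  have hc' : (c : ℚ) ≠ 0 := by positivity
  push_cast
  field_simp

theorem eq_const_of_cycRotAt_eq {M : Type} {i : DivIdx} {f : Fin i.val → M}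
    (h : cycRotAt M i f = f) (k : Fin i.val) : f k = f ⟨0, i.pos⟩ := by
  obtain ⟨k, hk⟩ := k
  induction k with
  | zero => rfl
  | succ k ih =>
    rw [← ih (by omega), ← congrFun h ⟨k + 1, hk⟩]
    unfold cycRotAt
    congr 1
    apply Fin.ext
    rw [val_sub_one_mod i.pos]
    have h1 : k + 1 + (i.val - 1) = k + i.val := by omega
    simp only [h1, Nat.add_mod_right]
    exact Nat.mod_eq_of_lt (by omega)

/-- The partial sums of a family with total sum zero give a preimage under `t - 1`. -/
theorem exists_cycRotAt_sub_eq {M : Type} [AddCommGroup M] {i : DivIdx} {f : Fin i.val → M}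
    (h : ∑ k, f k = 0) : ∃ g, cycRotAt M i g - g = f := by
  let F : ℕ → M := fun k => f ⟨k % i.val, Nat.mod_lt _ i.pos⟩
  have hF (k : Fin i.val) : F k = f k := by simp [F, Nat.mod_eq_of_lt k.isLt]
  have h0 : ∑ k ∈ Finset.range i.val, F k = 0 := by
    rw [← Fin.sum_univ_eq_sum_range, ← h]
    exact Finset.sum_congr rfl fun k _ => hF k
  refine ⟨fun k => -∑ j ∈ Finset.range (k + 1), F j, ?_⟩
  funext k
  rw [Pi.sub_apply, cycRotAt, Finset.sum_range_succ _ (k : ℕ), hF, val_sub_one_mod i.pos]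
  have key : ∑ j ∈ Finset.range ((k + (i.val - 1)) % i.val + 1), F j =
      ∑ j ∈ Finset.range k, F j := by
    have hi := i.pos
    obtain ⟨k, hk⟩ := k
    cases k with
    | zero =>
      have h1 : i.val - 1 + 1 = i.val := by omega
      simp only [zero_add, Finset.range_zero, Finset.sum_empty]
      rw [Nat.mod_eq_of_lt (by omega), h1, h0]
    | succ k =>
      have h1 : k + 1 + (i.val - 1) = k + i.val := by omega
      simp only [h1, Nat.add_mod_right]
      rw [Nat.mod_eq_of_lt (by omega)]
  rw [key]
  abel

/-- with `D = colim_m ℤ^m` (transition maps the concatenations), `t` the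
endomorphism of `D` induced by the cyclic rotations, `Δ : ℤ → D` induced by the diagonal
maps `ℤ → ℤ^m`, and `S′ : D → ℚ` induced by `f ↦ (Σ_i f_i)/m`, the sequence
`0 → ℤ → D → D → ℚ → 0` with maps `Δ`, `t - id`, `S′` is exact. -/
theorem weil_etale_stmt_14 :
    ∃ t : DD ℤ →+ DD ℤ,
      (∀ (i : DivIdx) (f : Fin i.val → ℤ), t (ofD ℤ i f) = ofD ℤ i (cycRotAt ℤ i f)) ∧
      ∃ Δ : ℤ →+ DD ℤ,
        (∀ (i : DivIdx) (x : ℤ), Δ x = ofD ℤ i (fun _ => x)) ∧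
        ∃ S' : DD ℤ →+ ℚ,
          (∀ (i : DivIdx) (f : Fin i.val → ℤ),
            S' (ofD ℤ i f) = (∑ k : Fin i.val, (f k : ℚ)) / (i.val : ℚ)) ∧
          Function.Injective Δ ∧
          Set.range Δ = {d : DD ℤ | t d = d} ∧
          Set.range (fun d : DD ℤ => t d - d) = {d : DD ℤ | S' d = 0} ∧
          Function.Surjective S' := by
  obtain ⟨t, ht⟩ := exists_hom_of_compatible (M := ℤ) (P := DD ℤ)
    (fun i => (ofD ℤ i).comp (AddMonoidHom.mk' (cycRotAt ℤ i) (cycRotAt_add i)))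
    fun i j hij f =>
      (congrArg (ofD ℤ j) (cycRotAt_piSystem hij f)).trans (ofD_piSystem hij (cycRotAt ℤ i f))
  replace ht (i : DivIdx) (f : Fin i.val → ℤ) : t (ofD ℤ i f) = ofD ℤ i (cycRotAt ℤ i f) :=
    ht i f
  obtain ⟨S', hS⟩ := exists_hom_of_compatible (M := ℤ) (P := ℚ)
    (fun i => AddMonoidHom.mk' (fun f => (∑ k, (f k : ℚ)) / (i.val : ℚ)) fun f g => by
      simp [Finset.sum_add_distrib, add_div]) (fun i j hij f => sum_piSystem hij f)
  replace hS (i : DivIdx) (f : Fin i.val → ℤ) :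
      S' (ofD ℤ i f) = (∑ k, (f k : ℚ)) / (i.val : ℚ) := hS i f
  let one : DivIdx := ⟨1, one_pos⟩
  let Δ : ℤ →+ DD ℤ := (ofD ℤ one).comp (AddMonoidHom.mk' (fun x _ => x) fun _ _ => rfl)
  have hΔ (i : DivIdx) (x : ℤ) : Δ x = ofD ℤ i fun _ => x :=
    (ofD_piSystem (show one ≤ i from one_dvd i.val) fun _ => x).symm
  refine ⟨t, ht, Δ, hΔ, S', hS, ?_, ?_, ?_, ?_⟩
  · intro x y hxy
    exact congrFun (ofD_injective ℤ one hxy) ⟨0, one_pos⟩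
  · ext d
    constructor
    · rintro ⟨x, rfl⟩
      exact ht one fun _ => x
    · intro hd
      obtain ⟨i, f, rfl⟩ := exists_ofD d
      have hf := ofD_injective ℤ i ((ht i f).symm.trans hd)
      refine ⟨f ⟨0, i.pos⟩, ?_⟩
      rw [hΔ i]
      congr 1
      funext k
      exact (eq_const_of_cycRotAt_eq hf k).symm
  · ext d
    constructor
    · rintro ⟨d, rfl⟩
      obtain ⟨i, f, rfl⟩ := exists_ofD d
      have h := congrArg (Int.cast : ℤ → ℚ) (sum_cycRotAt i f)
      push_cast at h
      simp only [Set.mem_ofPred_eq]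
      rw [map_sub, ht, hS, hS, h, sub_self]
    · intro hd
      obtain ⟨i, f, rfl⟩ := exists_ofD d
      have hi : (i.val : ℚ) ≠ 0 := Nat.cast_ne_zero.mpr i.pos.ne'
      rw [Set.mem_ofPred_eq, hS, div_eq_zero_iff, or_iff_left hi] at hd
      obtain ⟨g, hg⟩ := exists_cycRotAt_sub_eq (f := f) (by exact_mod_cast hd)
      refine ⟨ofD ℤ i g, ?_⟩
      simp only
      rw [ht, ← map_sub, hg]
  · intro q
    let i : DivIdx := ⟨q.den, q.pos⟩
    refine ⟨ofD ℤ i (Pi.single ⟨0, i.pos⟩ q.num), ?_⟩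
    rw [hS, ← Int.cast_sum, Finset.sum_pi_single']
    simpa [i] using Rat.num_div_den q
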